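/- Let h : (0,∞) → (0,∞) be a super-multiplicative function satisfying h(t) ≥ t for all t > 0. Let r > 0, let f : (a,b) → ℝ be an h-mid-convex function with 0 ∈ (a,b), (−r, r) ⊆ (a,b), f(0) = 0, and suppose f(x) ≤ M for all x ∈ (−r, r). Then for every rational t ∈ (0,1) and every x ∈ ℝ with |x| ≤ t·r and x/t ∈ (−r,r), −x/t ∈ (−r,r), one has |f(x)| ≤ h(t)·M. -/

import Mathlib

/-- A super-multiplicative positive function dominating the identity is the identity. -/
theorem eq_self_of_supermul {h : ℝ → ℝ}
    (h_supermul : ∀ x y : ℝ, 0 < x → 0 < y → h x * h y ≤ h (x * y))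
    (h_ge : ∀ t : ℝ, 0 < t → t ≤ h t) {t : ℝ} (ht : 0 < t) : h t = t := by
  refine le_antisymm ?_ (h_ge t ht)
  have h1 : h 1 ≤ 1 := by
    have h11 := h_supermul 1 1 one_pos one_pos
    rw [mul_one] at h11
    nlinarith [h_ge 1 one_pos]
  have hinv := h_supermul t t⁻¹ ht (inv_pos.2 ht)
  rw [mul_inv_cancel₀ ht.ne'] at hinv
  have hmul : h t * t⁻¹ ≤ h t * h t⁻¹ :=
    mul_le_mul_of_nonneg_left (h_ge _ (inv_pos.2 ht)) (ht.le.trans (h_ge t ht))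
  have hdiv : h t / t ≤ 1 := by
    rw [div_eq_mul_inv]
    linarith
  simpa using (div_le_iff₀ ht).1 hdiv

/-- For a finite convex sequence starting at `0`, the slopes from the origin increase
in one step. -/
theorem succ_mul_le_mul_succ_of_convex_seq {u : ℕ → ℝ} {q : ℕ} (u_zero : u 0 = 0)
    (hu : ∀ k, k + 2 ≤ q → 2 * u (k + 1) ≤ u k + u (k + 2)) (k : ℕ) (hk : k + 1 ≤ q) :
    ((k : ℝ) + 1) * u k ≤ k * u (k + 1) := by
  induction k with
  | zero => simp [u_zero]
  | succ k ih =>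
    have hk0 : (0 : ℝ) ≤ k := k.cast_nonneg
    have hstep := mul_le_mul_of_nonneg_left (hu k hk) (by positivity : (0 : ℝ) ≤ (k : ℝ) + 1)
    push_cast
    linarith [ih (by omega)]

/-- For a finite convex sequence starting at `0`, the slopes from the origin are monotone. -/
theorem mul_le_mul_of_convex_seq {u : ℕ → ℝ} {q : ℕ} (u_zero : u 0 = 0)
    (hu : ∀ k, k + 2 ≤ q → 2 * u (k + 1) ≤ u k + u (k + 2)) {p : ℕ} (hp : 0 < p)
    {m : ℕ} (hpm : p ≤ m) (hm : m ≤ q) : (m : ℝ) * u p ≤ p * u m := by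
  induction m, hpm using Nat.le_induction with
  | base => exact le_rfl
  | succ m hpm ih =>
    have hm0 : (0 : ℝ) < m := by exact_mod_cast hp.trans_le hpm
    have hp0 : (0 : ℝ) ≤ p := p.cast_nonneg
    have hslope := mul_le_mul_of_nonneg_left
      (succ_mul_le_mul_succ_of_convex_seq u_zero hu m hm) hp0
    have hprev := mul_le_mul_of_nonneg_left (ih (by omega))
      (by positivity : (0 : ℝ) ≤ (m : ℝ) + 1)
    push_cast
    refine le_of_mul_le_mul_left ?_ hm0
    linarith

/-- A midpoint-convex function on an interval around `0` vanishing at `0` satisfies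
`f (t * y) ≤ t * f y` for rational `t ∈ (0, 1)`. -/
theorem map_ratCast_mul_le_of_midconvex {a b : ℝ} {f : ℝ → ℝ} (h0 : (0 : ℝ) ∈ Set.Ioo a b)
    (hf : ∀ x ∈ Set.Ioo a b, ∀ y ∈ Set.Ioo a b, 2 * f ((x + y) / 2) ≤ f x + f y)
    (f_zero : f 0 = 0) {y : ℝ} (hy : y ∈ Set.Ioo a b) {t : ℚ} (ht0 : 0 < t) (ht1 : t < 1) :
    f (t * y) ≤ t * f y := by
  have hq : (0 : ℝ) < t.den := by exact_mod_cast t.den_pos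
  obtain ⟨p, hp⟩ := Int.eq_ofNat_of_zero_le (Rat.num_nonneg.2 ht0.le)
  have htp : (t : ℝ) = p / t.den := by
    rw [Rat.cast_def, hp]
    simp
  have hp0 : 0 < p := by
    have := Rat.num_pos.2 ht0
    omega
  have hpq : p ≤ t.den := by
    have ht1' : (t : ℝ) < 1 := by exact_mod_cast ht1
    rw [htp, div_lt_one hq] at ht1'
    exact_mod_cast ht1'.le
  have hmem : ∀ k : ℕ, k ≤ t.den → (k : ℝ) / t.den * y ∈ Set.Ioo a b := by
    intro k hk
    have hk1 : (k : ℝ) / t.den ≤ 1 := by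
      rw [div_le_one hq]
      exact_mod_cast hk
    simpa using (convex_Ioo a b).smul_mem_of_zero_mem h0 hy ⟨by positivity, hk1⟩
  have key := mul_le_mul_of_convex_seq (u := fun k : ℕ => f ((k : ℝ) / t.den * y)) (q := t.den)
    (by simpa using f_zero)
    (fun k hk => by
      have hmid := hf _ (hmem k (by omega)) _ (hmem (k + 2) hk)
      have heq : ((k : ℝ) / t.den * y + ((k + 2 : ℕ) : ℝ) / t.den * y) / 2
          = ((k + 1 : ℕ) : ℝ) / t.den * y := by
        push_cast
        ring
      rwa [heq] at hmid)
    hp0 hpq le_rfl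
  simp only [div_self hq.ne', one_mul] at key
  rw [htp, div_mul_eq_mul_div (p : ℝ) _ (f y), le_div_iff₀ hq]
  linarith


theorem h_mid_convex_local_bound
    (a b r M : ℝ) (h f : ℝ → ℝ)
    (h_pos : ∀ t : ℝ, 0 < t → 0 < h t)
    (h_supermul : ∀ x y : ℝ, 0 < x → 0 < y → h x * h y ≤ h (x * y))
    (h_ge : ∀ t : ℝ, 0 < t → t ≤ h t)
    (hr : 0 < r)
    (h0mem : (0 : ℝ) ∈ Set.Ioo a b)
    (hsub : Set.Ioo (-r) r ⊆ Set.Ioo a b)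
    (f_midconv : ∀ x ∈ Set.Ioo a b, ∀ y ∈ Set.Ioo a b,
      f ((x + y) / 2) ≤ h (1 / 2) * (f x + f y))
    (f_zero : f 0 = 0)
    (f_bdd : ∀ x ∈ Set.Ioo (-r) r, f x ≤ M) :
    ∀ t : ℚ, 0 < t → t < 1 → ∀ x : ℝ, |x| ≤ (t : ℝ) * r →
      x / (t : ℝ) ∈ Set.Ioo (-r) r → -x / (t : ℝ) ∈ Set.Ioo (-r) r →
      |f x| ≤ h (t : ℝ) * M := by
  intro t ht0 ht1 x _ hx hnx
  have ht : (0 : ℝ) < t := by exact_mod_cast ht0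
  have hf : ∀ x ∈ Set.Ioo a b, ∀ y ∈ Set.Ioo a b, 2 * f ((x + y) / 2) ≤ f x + f y := by
    intro x hx y hy
    have hxy := f_midconv x hx y hy
    rw [eq_self_of_supermul h_supermul h_ge (by norm_num : (0 : ℝ) < 1 / 2)] at hxy
    linarith
  have upper : ∀ z : ℝ, z / t ∈ Set.Ioo (-r) r → f z ≤ t * M := by
    intro z hz
    have hle := map_ratCast_mul_le_of_midconvex h0mem hf f_zero (hsub hz) ht0 ht1
    rw [mul_div_cancel₀ z ht.ne'] at hle
    exact hle.trans (mul_le_mul_of_nonneg_left (f_bdd _ hz) ht.le)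
  have hmem : ∀ z : ℝ, z / t ∈ Set.Ioo (-r) r → z ∈ Set.Ioo a b := by
    intro z hz
    have ht1' : (t : ℝ) ≤ 1 := by exact_mod_cast ht1.le
    have hsmul := (convex_Ioo a b).smul_mem_of_zero_mem h0mem (hsub hz) ⟨ht.le, ht1'⟩
    rwa [smul_eq_mul, mul_div_cancel₀ z ht.ne'] at hsmul
  have hsym := hf x (hmem x hx) (-x) (hmem (-x) hnx)
  rw [add_neg_cancel, zero_div, f_zero] at hsym
  rw [eq_self_of_supermul h_supermul h_ge ht, abs_le]
  exact ⟨by linarith [upper (-x) hnx], upper x hx⟩
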